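/- arXiv:2011.10792 — 2 statements merged into one kernel-verified Lean document; each statement's English description precedes it below -/
import Mathlib

section
/- Let L, H, g > 0 and k₀, ū ≥ 0. Let k : [0,L] × [0,H] → ℝ be C¹ with 0 ≤ k ≤ k₀ and ∂_z k ≥ 0 everywhere, and let u : [0,L] × [0,H] → ℝ be C¹ with |u| ≤ ū. Then ∫_{(0,L)×(0,H)} k |∇u + g e_z|² ≥ g² ∫_{(0,L)×(0,H)} k − 6 g k₀ ū L, where e_z = (0,1) and |·| is the Euclidean norm on ℝ². -/
open MeasureTheory Set Filter

/-- Partial derivative in the first (horizontal, `y`) variable. -/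
noncomputable def pdy (f : ℝ × ℝ → ℝ) (x : ℝ × ℝ) : ℝ := deriv (fun t => f (t, x.2)) x.1

/-- Partial derivative in the second (vertical, `z`) variable. -/
noncomputable def pdz (f : ℝ × ℝ → ℝ) (x : ℝ × ℝ) : ℝ := deriv (fun t => f (x.1, t)) x.2

/-- The product of a nonnegative nondecreasing function bounded by `M` and the derivative of a
function bounded by `B` has integral at least `-2 M B`. -/
lemma neg_two_mul_mul_le_integral_mul_deriv {a b M B : ℝ} (hab : a ≤ b) (hB : 0 ≤ B)
    {f f' v v' : ℝ → ℝ}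
    (hf : ∀ t ∈ Icc a b, HasDerivAt f (f' t) t) (hv : ∀ t ∈ Icc a b, HasDerivAt v (v' t) t)
    (hf'c : ContinuousOn f' (Icc a b)) (hv'c : ContinuousOn v' (Icc a b))
    (hf' : ∀ t ∈ Icc a b, 0 ≤ f' t) (hfM : ∀ t ∈ Icc a b, f t ∈ Icc 0 M)
    (hvB : ∀ t ∈ Icc a b, |v t| ≤ B) :
    -2 * M * B ≤ ∫ t in a..b, f t * v' t := by
  have hI : uIcc a b = Icc a b := uIcc_of_le hab
  have hf'i : IntervalIntegrable f' volume a b := (hI ▸ hf'c).intervalIntegrable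
  have hv'i : IntervalIntegrable v' volume a b := (hI ▸ hv'c).intervalIntegrable
  have hvc : ContinuousOn v (Icc a b) := fun t ht => (hv t ht).continuousAt.continuousWithinAt
  have hparts := intervalIntegral.integral_mul_deriv_eq_deriv_mul
    (fun t ht => hf t (hI ▸ ht)) (fun t ht => hv t (hI ▸ ht)) hf'i hv'i
  have hftc := intervalIntegral.integral_eq_sub_of_hasDerivAt (fun t ht => hf t (hI ▸ ht)) hf'i
  have hle : ∫ t in a..b, f' t * v t ≤ ∫ t in a..b, f' t * B := by
    refine intervalIntegral.integral_mono_on hab ?_ (hf'i.mul_const B) fun t ht =>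
      mul_le_mul_of_nonneg_left (le_of_abs_le (hvB t ht)) (hf' t ht)
    exact ContinuousOn.intervalIntegrable (hI ▸ hf'c.mul hvc)
  rw [intervalIntegral.integral_mul_const, hftc] at hle
  have ha : a ∈ Icc a b := left_mem_Icc.2 hab
  have hb : b ∈ Icc a b := right_mem_Icc.2 hab
  have h1 := mul_le_mul_of_nonneg_left (abs_le.1 (hvB b hb)).1 (hfM b hb).1
  have h2 := mul_le_mul_of_nonneg_left (abs_le.1 (hvB a ha)).2 (hfM a ha).1
  have h3 := mul_le_mul_of_nonneg_right (hfM b hb).2 hB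
  rw [hparts]
  linarith

section PartialDerivatives

variable {f : ℝ × ℝ → ℝ} {U : Set (ℝ × ℝ)}

lemma hasDerivAt_fst (hU : IsOpen U) (hf : ContDiffOn ℝ 1 f U) {x : ℝ × ℝ} (hx : x ∈ U) :
    HasDerivAt (fun t => f (t, x.2)) (fderiv ℝ f x (1, 0)) x.1 :=
  ((hf.differentiableOn one_ne_zero).differentiableAt
    (hU.mem_nhds hx)).hasFDerivAt.comp_hasDerivAt x.1
      ((hasDerivAt_id x.1).prodMk (hasDerivAt_const x.1 x.2))

lemma hasDerivAt_snd (hU : IsOpen U) (hf : ContDiffOn ℝ 1 f U) {x : ℝ × ℝ} (hx : x ∈ U) :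
    HasDerivAt (fun t => f (x.1, t)) (fderiv ℝ f x (0, 1)) x.2 :=
  ((hf.differentiableOn one_ne_zero).differentiableAt
    (hU.mem_nhds hx)).hasFDerivAt.comp_hasDerivAt x.2
      ((hasDerivAt_const x.2 x.1).prodMk (hasDerivAt_id x.2))

lemma hasDerivAt_pdz (hU : IsOpen U) (hf : ContDiffOn ℝ 1 f U) {x : ℝ × ℝ} (hx : x ∈ U) :
    HasDerivAt (fun t => f (x.1, t)) (pdz f x) x.2 :=
  (hasDerivAt_snd hU hf hx).differentiableAt.hasDerivAt

lemma continuousOn_pdy (hU : IsOpen U) (hf : ContDiffOn ℝ 1 f U) : ContinuousOn (pdy f) U :=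
  ((hf.continuousOn_fderiv_of_isOpen hU le_rfl).clm_apply continuousOn_const).congr
    fun _ hx => (hasDerivAt_fst hU hf hx).deriv

lemma continuousOn_pdz (hU : IsOpen U) (hf : ContDiffOn ℝ 1 f U) : ContinuousOn (pdz f) U :=
  ((hf.continuousOn_fderiv_of_isOpen hU le_rfl).clm_apply continuousOn_const).congr
    fun _ hx => (hasDerivAt_snd hU hf hx).deriv

end PartialDerivatives

/-- Jensen-type inequality:
`∫ k |∇u + g e_z|² ≥ g² ∫ k − 6 g k₀ ū L` on the rectangle `(0,L) × (0,H)`. -/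
theorem jensen_type_inequality
    (L H g k₀ uBar : ℝ) (hL : 0 < L) (hH : 0 < H) (hg : 0 < g)
    (hk₀ : 0 ≤ k₀) (huBar : 0 ≤ uBar)
    (k u : ℝ × ℝ → ℝ) (U : Set (ℝ × ℝ)) (hU : IsOpen U)
    (hUsub : Icc (0:ℝ) L ×ˢ Icc (0:ℝ) H ⊆ U)
    (hkC1 : ContDiffOn ℝ 1 k U) (huC1 : ContDiffOn ℝ 1 u U)
    (hkbound : ∀ x ∈ Icc (0:ℝ) L ×ˢ Icc (0:ℝ) H, k x ∈ Icc (0:ℝ) k₀)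
    (hkmono : ∀ x ∈ Icc (0:ℝ) L ×ˢ Icc (0:ℝ) H, 0 ≤ pdz k x)
    (hubound : ∀ x ∈ Icc (0:ℝ) L ×ˢ Icc (0:ℝ) H, |u x| ≤ uBar) :
    (∫ x in Ioo (0:ℝ) L ×ˢ Ioo (0:ℝ) H,
        k x * ((pdy u x) ^ 2 + (pdz u x + g) ^ 2))
      ≥ g ^ 2 * (∫ x in Ioo (0:ℝ) L ×ˢ Ioo (0:ℝ) H, k x) - 6 * g * k₀ * uBar * L := by
  have hRsub : Ioo (0:ℝ) L ×ˢ Ioo (0:ℝ) H ⊆ Icc (0:ℝ) L ×ˢ Icc (0:ℝ) H :=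
    prod_mono Ioo_subset_Icc_self Ioo_subset_Icc_self
  have hRmeas : MeasurableSet (Ioo (0:ℝ) L ×ˢ Ioo (0:ℝ) H) :=
    measurableSet_Ioo.prod measurableSet_Ioo
  have hint {φ : ℝ × ℝ → ℝ} (hφ : ContinuousOn φ U) :
      IntegrableOn φ (Ioo (0:ℝ) L ×ˢ Ioo (0:ℝ) H) :=
    ((hφ.mono hUsub).integrableOn_compact (isCompact_Icc.prod isCompact_Icc)).mono_set hRsub
  have hkc := hkC1.continuousOn
  have huy := continuousOn_pdy hU huC1
  have huz := continuousOn_pdz hU huC1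
  have hkz := continuousOn_pdz hU hkC1
  have hkuz : IntegrableOn (fun x => k x * pdz u x) (Ioo (0:ℝ) L ×ˢ Ioo (0:ℝ) H) :=
    hint (hkc.mul huz)
  have hmain : -2 * k₀ * uBar * L ≤
      ∫ x in Ioo (0:ℝ) L ×ˢ Ioo (0:ℝ) H, k x * pdz u x := by
    rw [Measure.volume_eq_prod] at hkuz ⊢
    rw [setIntegral_prod _ hkuz]
    have hinner : ∀ y ∈ Ioo 0 L,
        -2 * k₀ * uBar ≤ ∫ z in Ioo 0 H, k (y, z) * pdz u (y, z) := by
      intro y hy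
      have hmem : ∀ z ∈ Icc 0 H, (y, z) ∈ Icc (0:ℝ) L ×ˢ Icc (0:ℝ) H :=
        fun z hz => ⟨Ioo_subset_Icc_self hy, hz⟩
      have hcont : ContinuousOn (fun z : ℝ => (y, z)) (Icc 0 H) := by fun_prop
      have hmaps : MapsTo (fun z : ℝ => (y, z)) (Icc 0 H) U := fun z hz => hUsub (hmem z hz)
      rw [← integral_Ioc_eq_integral_Ioo, ← intervalIntegral.integral_of_le hH.le]
      exact neg_two_mul_mul_le_integral_mul_deriv hH.le huBar
        (fun z hz => hasDerivAt_pdz hU hkC1 (hmaps hz))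
        (fun z hz => hasDerivAt_pdz hU huC1 (hmaps hz))
        (hkz.comp hcont hmaps) (huz.comp hcont hmaps)
        (fun z hz => hkmono _ (hmem z hz)) (fun z hz => hkbound _ (hmem z hz))
        (fun z hz => hubound _ (hmem z hz))
    have houter : IntegrableOn (fun y => ∫ z in Ioo 0 H, k (y, z) * pdz u (y, z)) (Ioo 0 L) := by
      rw [IntegrableOn, ← Measure.prod_restrict] at hkuz
      exact hkuz.integral_prod_left
    calc -2 * k₀ * uBar * L = ∫ _ in Ioo 0 L, -2 * k₀ * uBar := by
          simp [hL.le, mul_comm]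
      _ ≤ _ := setIntegral_mono_on (integrableOn_const (by simp)) houter measurableSet_Ioo hinner
  have hpoint : ∫ x in Ioo (0:ℝ) L ×ˢ Ioo (0:ℝ) H, (g ^ 2 * k x + 2 * g * (k x * pdz u x)) ≤
      ∫ x in Ioo (0:ℝ) L ×ˢ Ioo (0:ℝ) H, k x * ((pdy u x) ^ 2 + (pdz u x + g) ^ 2) := by
    refine setIntegral_mono_on (((hint hkc).const_mul _).add (hkuz.const_mul _))
      (hint (hkc.mul ((huy.pow 2).add ((huz.add continuousOn_const).pow 2)))) hRmeas
      fun x hx => ?_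
    have := mul_nonneg (hkbound x (hRsub hx)).1
      (add_nonneg (sq_nonneg (pdy u x)) (sq_nonneg (pdz u x)))
    linarith
  rw [integral_add ((hint hkc).const_mul _) (hkuz.const_mul _), integral_const_mul,
    integral_const_mul] at hpoint
  have hscaled := mul_le_mul_of_nonneg_left hmain (by positivity : 0 ≤ 2 * g)
  have hslack : 0 ≤ g * k₀ * uBar * L := by positivity
  linarith
end

section
/- Let L, h, c, g, κ > 0, C_L ≥ 0, and let k : ℝ → ℝ be continuously differentiable with k ≥ κ. Let s be C¹ and p be C² on an open set containing [0,L] × [0,h], satisfying at every point the divergence-form equation ∂_y(k(s) ∂_y p) + ∂_z(k(s) ∂_z p) = (c − g k'(s)) ∂_z s, together with: ∂_z s ≥ 0 everywhere; p(x) ≥ 0 at every point x where ∂_z s(x) > 0; p(y,0) ≥ −C_L and p(y,h) ≥ −C_L for all y ∈ [0,L]; and ∂_y p(0,z) = ∂_y p(L,z) = 0 for all z ∈ [0,h]. Then p(x) ≥ −C_L for every x ∈ [0,L] × [0,h]. -/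
open MeasureTheory Set Filter

theorem pdy_eq_fderiv {f : ℝ × ℝ → ℝ} {x : ℝ × ℝ} (hf : DifferentiableAt ℝ f x) :
    pdy f x = fderiv ℝ f x (1, 0) := by
  have h1 : HasDerivAt (fun t : ℝ => (t, x.2)) ((1 : ℝ), (0 : ℝ)) x.1 :=
    (hasDerivAt_id x.1).prodMk (hasDerivAt_const x.1 x.2)
  exact (HasFDerivAt.comp_hasDerivAt (l := f) x.1 hf.hasFDerivAt h1).deriv

theorem pdz_eq_fderiv {f : ℝ × ℝ → ℝ} {x : ℝ × ℝ} (hf : DifferentiableAt ℝ f x) :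
    pdz f x = fderiv ℝ f x (0, 1) := by
  have h1 : HasDerivAt (fun t : ℝ => (x.1, t)) ((0 : ℝ), (1 : ℝ)) x.2 :=
    (hasDerivAt_const x.2 x.1).prodMk (hasDerivAt_id x.2)
  exact (HasFDerivAt.comp_hasDerivAt (l := f) x.2 hf.hasFDerivAt h1).deriv

theorem contDiffOn_pdy {f : ℝ × ℝ → ℝ} {U : Set (ℝ × ℝ)} (hU : IsOpen U)
    (hf : ContDiffOn ℝ 2 f U) : ContDiffOn ℝ 1 (pdy f) U :=
  ((hf.fderiv_of_isOpen (m := 1) hU (by norm_num)).clm_apply contDiffOn_const).congr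
    fun _ hx => pdy_eq_fderiv ((hf.contDiffAt (hU.mem_nhds hx)).differentiableAt (by norm_num))

theorem contDiffOn_pdz {f : ℝ × ℝ → ℝ} {U : Set (ℝ × ℝ)} (hU : IsOpen U)
    (hf : ContDiffOn ℝ 2 f U) : ContDiffOn ℝ 1 (pdz f) U :=
  ((hf.fderiv_of_isOpen (m := 1) hU (by norm_num)).clm_apply contDiffOn_const).congr
    fun _ hx => pdz_eq_fderiv ((hf.contDiffAt (hU.mem_nhds hx)).differentiableAt (by norm_num))

theorem hasDerivAt_min_zero_sq (u : ℝ) :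
    HasDerivAt (fun t : ℝ => min t 0 ^ 2) (2 * min u 0) u := by
  rcases lt_trichotomy u 0 with hu | rfl | hu
  · rw [min_eq_left hu.le]
    refine HasDerivAt.congr_of_eventuallyEq (f := fun t : ℝ => t ^ 2) ?_ ?_
    · simpa using hasDerivAt_pow 2 u
    · filter_upwards [gt_mem_nhds hu] with t ht
      rw [min_eq_left ht.le]
  · have h0 : HasDerivAt (fun t : ℝ => t ^ 2) 0 0 := by simpa using hasDerivAt_pow 2 (0 : ℝ)
    rw [hasDerivAt_iff_isLittleO_nhds_zero] at h0 ⊢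
    refine Asymptotics.IsBigO.trans_isLittleO (.of_bound 1 (.of_forall fun t => ?_)) h0
    have : min t 0 ^ 2 ≤ t ^ 2 := by
      rcases le_total t 0 with ht | ht
      · rw [min_eq_left ht]
      · simp [min_eq_right ht, sq_nonneg]
    simpa using this
  · rw [min_eq_right hu.le]
    refine HasDerivAt.congr_of_eventuallyEq (f := fun _ : ℝ => (0 : ℝ)) ?_ ?_
    · simpa using hasDerivAt_const u (0 : ℝ)
    · filter_upwards [lt_mem_nhds hu] with t ht
      simp [min_eq_right ht.le]

theorem eqOn_zero_of_setIntegral_eq_zero {X : Type*} [TopologicalSpace X] [MeasurableSpace X]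
    [OpensMeasurableSpace X] [T2Space X] {μ : Measure X} [μ.IsOpenPosMeasure]
    [IsFiniteMeasureOnCompacts μ] {K : Set X} (hK : IsCompact K) (hKi : K ⊆ closure (interior K))
    {f : X → ℝ} (hf : ContinuousOn f K) (hf0 : ∀ x ∈ K, 0 ≤ f x) (hint : ∫ x in K, f x ∂μ = 0) :
    EqOn f 0 K := by
  refine Measure.eqOn_of_ae_eq (μ := μ) ?_ hf continuousOn_const hKi
  refine (setIntegral_eq_zero_iff_of_nonneg_ae ?_ (hf.integrableOn_compact' hK hK.measurableSet)).1
    hint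
  exact (ae_restrict_mem hK.measurableSet).mono hf0

/-- Maximum-principle lower bound for the pressure: if `p ≥ −C_L` on the top and bottom
boundaries, `p ≥ 0` wherever `∂_z s > 0`, and `p` solves the divergence-form travelling-wave
equation, then `p ≥ −C_L` on the whole rectangle. -/
theorem pressure_lower_bound
    (L h c g κ CL : ℝ) (hL : 0 < L) (hh : 0 < h) (hc : 0 < c) (hg : 0 < g)
    (hκ : 0 < κ) (hCL : 0 ≤ CL)
    (k : ℝ → ℝ) (hk : ContDiff ℝ 1 k) (hkκ : ∀ σ : ℝ, κ ≤ k σ)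
    (s p : ℝ × ℝ → ℝ) (U : Set (ℝ × ℝ)) (hU : IsOpen U)
    (hUsub : Icc (0:ℝ) L ×ˢ Icc (0:ℝ) h ⊆ U)
    (hs : ContDiffOn ℝ 1 s U) (hp : ContDiffOn ℝ 2 p U)
    (hEq : ∀ x ∈ Icc (0:ℝ) L ×ˢ Icc (0:ℝ) h,
      pdy (fun x' => k (s x') * pdy p x') x + pdz (fun x' => k (s x') * pdz p x') x
        = (c - g * deriv k (s x)) * pdz s x)
    (hsz : ∀ x ∈ Icc (0:ℝ) L ×ˢ Icc (0:ℝ) h, 0 ≤ pdz s x)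
    (hpos : ∀ x ∈ Icc (0:ℝ) L ×ˢ Icc (0:ℝ) h, 0 < pdz s x → 0 ≤ p x)
    (hbottom : ∀ y ∈ Icc (0:ℝ) L, -CL ≤ p (y, 0))
    (htop : ∀ y ∈ Icc (0:ℝ) L, -CL ≤ p (y, h))
    (hNeu : ∀ z ∈ Icc (0:ℝ) h, pdy p (0, z) = 0 ∧ pdy p (L, z) = 0) :
    ∀ x ∈ Icc (0:ℝ) L ×ˢ Icc (0:ℝ) h, -CL ≤ p x := by
  set R : Set (ℝ × ℝ) := Icc (0:ℝ) L ×ˢ Icc (0:ℝ) h with hR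
  have hRIcc : R = Icc ((0:ℝ), (0:ℝ)) (L, h) := Icc_prod_Icc _ _ _ _
  have hRcomp : IsCompact R := isCompact_Icc.prod isCompact_Icc
  have hRint : R ⊆ closure (interior R) := by
    rw [hR, interior_prod_eq, closure_prod_eq, interior_Icc, interior_Icc, closure_Ioo hL.ne,
      closure_Ioo hh.ne]
  set A : ℝ × ℝ → ℝ := fun x => k (s x) * pdy p x with hA
  set B : ℝ × ℝ → ℝ := fun x => k (s x) * pdz p x with hB
  set m : ℝ × ℝ → ℝ := fun x => min (p x + CL) 0 with hm
  have hks : ContDiffOn ℝ 1 (fun x => k (s x)) U := hk.comp_contDiffOn hs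
  have hA1 : ContDiffOn ℝ 1 A U := hks.mul (contDiffOn_pdy hU hp)
  have hB1 : ContDiffOn ℝ 1 B U := hks.mul (contDiffOn_pdz hU hp)
  have hmc : ContinuousOn m U :=
    ContinuousOn.inf (hp.continuousOn.add continuousOn_const) continuousOn_const
  have hpd : ∀ x ∈ U, DifferentiableAt ℝ p x := fun x hx =>
    (hp.contDiffAt (hU.mem_nhds hx)).differentiableAt (by norm_num)
  have hAd : ∀ x ∈ U, DifferentiableAt ℝ A x := fun x hx =>
    (hA1.contDiffAt (hU.mem_nhds hx)).differentiableAt (by norm_num)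
  have hBd : ∀ x ∈ U, DifferentiableAt ℝ B x := fun x hx =>
    (hB1.contDiffAt (hU.mem_nhds hx)).differentiableAt (by norm_num)
  have hmd : ∀ x ∈ U, HasFDerivAt (fun x => m x ^ 2) ((2 * m x) • fderiv ℝ p x) x :=
    fun x hx => (hasDerivAt_min_zero_sq (p x + CL)).comp_hasFDerivAt
      (f := fun x => p x + CL) x ((hpd x hx).hasFDerivAt.add_const CL)
  set E : ℝ × ℝ → ℝ := fun x => -(2 * m x * k (s x) * (pdy p x ^ 2 + pdz p x ^ 2)) with hE
  have hm0 : ∀ x, m x ≤ 0 := fun x => min_le_right _ _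
  have hk0 : ∀ σ, 0 < k σ := fun σ => hκ.trans_le (hkκ σ)
  have hE0 : ∀ x ∈ R, 0 ≤ E x := fun x _ => by
    have h1 : 0 ≤ -m x * k (s x) * (pdy p x ^ 2 + pdz p x ^ 2) := by
      have := hm0 x
      have := hk0 (s x)
      have : 0 ≤ -m x := by linarith
      positivity
    simp only [hE]
    linarith
  have hEc : ContinuousOn E R := by
    refine ContinuousOn.mono ?_ hUsub
    have h1 := (contDiffOn_pdy hU hp).continuousOn
    have h2 := (contDiffOn_pdz hU hp).continuousOn
    have h3 := hks.continuousOn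
    exact (((continuousOn_const.mul hmc).mul h3).mul ((h1.pow 2).add (h2.pow 2))).neg
  set F' : ℝ × ℝ → ℝ × ℝ →L[ℝ] ℝ :=
    fun x => (m x ^ 2) • fderiv ℝ A x + A x • ((2 * m x) • fderiv ℝ p x) with hF'
  set G' : ℝ × ℝ → ℝ × ℝ →L[ℝ] ℝ :=
    fun x => (m x ^ 2) • fderiv ℝ B x + B x • ((2 * m x) • fderiv ℝ p x) with hG'
  have hdiv : ∀ x ∈ R, F' x (1, 0) + G' x (0, 1) = -E x := fun x hx => by
    have hxU := hUsub hx
    have h1 := hEq x hx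
    rw [pdy_eq_fderiv (hAd x hxU), pdz_eq_fderiv (hBd x hxU)] at h1
    have h2 : m x ^ 2 * pdz s x = 0 := by
      rcases (hsz x hx).eq_or_lt with h0 | h0
      · rw [← h0, mul_zero]
      · have : m x = 0 := min_eq_right (by linarith [hpos x hx h0])
        simp [this]
    simp only [hF', hG', hE, add_apply, smul_apply,
      smul_eq_mul, ← pdy_eq_fderiv (hpd x hxU), ← pdz_eq_fderiv (hpd x hxU)]
    simp only [hA, hB] at h1 ⊢
    linear_combination m x ^ 2 * h1 + (c - g * deriv k (s x)) * h2
  have hint : ∫ x in R, E x = 0 := by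
    have hdivint : IntegrableOn (fun x => F' x (1, 0) + G' x (0, 1)) R :=
      (hEc.neg.integrableOn_compact hRcomp).congr_fun (fun x hx => (hdiv x hx).symm)
        hRcomp.measurableSet
    have hIoo : Ioo 0 L ×ˢ Ioo 0 h ⊆ U :=
      (Set.prod_mono Ioo_subset_Icc_self Ioo_subset_Icc_self).trans hUsub
    have hsq : ContinuousOn (fun x => m x ^ 2) R := (hmc.mono hUsub).pow 2
    have hmain := integral_divergence_prod_Icc_of_hasFDerivAt_of_le
      (fun x => m x ^ 2 * A x) (fun x => m x ^ 2 * B x) F' G' (0, 0) (L, h) ⟨hL.le, hh.le⟩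
      (by rw [← hRIcc]; exact hsq.mul (hA1.continuousOn.mono hUsub))
      (by rw [← hRIcc]; exact hsq.mul (hB1.continuousOn.mono hUsub))
      (fun x hx => (hmd x (hIoo hx)).mul (hAd x (hIoo hx)).hasFDerivAt)
      (fun x hx => (hmd x (hIoo hx)).mul (hBd x (hIoo hx)).hasFDerivAt)
      (by rwa [← hRIcc])
    rw [← hRIcc, setIntegral_congr_fun hRcomp.measurableSet hdiv, integral_neg] at hmain
    have htop0 : ∫ y in (0:ℝ)..L, m (y, h) ^ 2 * B (y, h) = 0 := by
      refine intervalIntegral.integral_zero_ae (.of_forall fun y hy => ?_)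
      rw [uIoc_of_le hL.le] at hy
      have : m (y, h) = 0 := min_eq_right (by linarith [htop y (Ioc_subset_Icc_self hy)])
      simp [this]
    have hbot0 : ∫ y in (0:ℝ)..L, m (y, 0) ^ 2 * B (y, 0) = 0 := by
      refine intervalIntegral.integral_zero_ae (.of_forall fun y hy => ?_)
      rw [uIoc_of_le hL.le] at hy
      have : m (y, 0) = 0 := min_eq_right (by linarith [hbottom y (Ioc_subset_Icc_self hy)])
      simp [this]
    have hright0 : ∫ z in (0:ℝ)..h, m (L, z) ^ 2 * A (L, z) = 0 := by
      refine intervalIntegral.integral_zero_ae (.of_forall fun z hz => ?_)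
      rw [uIoc_of_le hh.le] at hz
      simp [hA, (hNeu z (Ioc_subset_Icc_self hz)).2]
    have hleft0 : ∫ z in (0:ℝ)..h, m (0, z) ^ 2 * A (0, z) = 0 := by
      refine intervalIntegral.integral_zero_ae (.of_forall fun z hz => ?_)
      rw [uIoc_of_le hh.le] at hz
      simp [hA, (hNeu z (Ioc_subset_Icc_self hz)).1]
    simp only [htop0, hbot0, hright0, hleft0] at hmain
    linarith
  have hEzero := eqOn_zero_of_setIntegral_eq_zero hRcomp hRint hEc hE0 hint
  have hmz : ∀ x ∈ R, m x * pdz p x = 0 := fun x hx => by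
    have h1 : 2 * m x * k (s x) * (pdy p x ^ 2 + pdz p x ^ 2) = 0 := neg_eq_zero.1 (hEzero hx)
    rcases mul_eq_zero.1 h1 with h2 | h2
    · have : m x = 0 := by simpa [(hk0 (s x)).ne'] using h2
      simp [this]
    · have : pdz p x = 0 := by nlinarith [sq_nonneg (pdy p x), sq_nonneg (pdz p x)]
      simp [this]
  rintro ⟨y, z⟩ hx
  have hderiv : ∀ t ∈ Icc 0 h, HasDerivAt (fun t => m (y, t) ^ 2) 0 t := fun t ht => by
    have hyt : (y, t) ∈ R := ⟨hx.1, ht⟩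
    have h1 : HasDerivAt (fun t : ℝ => (y, t)) ((0 : ℝ), (1 : ℝ)) t :=
      (hasDerivAt_const t y).prodMk (hasDerivAt_id t)
    have h2 := HasFDerivAt.comp_hasDerivAt (l := fun x => m x ^ 2) t (hmd _ (hUsub hyt)) h1
    rw [smul_apply, ← pdz_eq_fderiv (hpd _ (hUsub hyt)), smul_eq_mul, mul_assoc,
      hmz _ hyt, mul_zero] at h2
    exact h2
  have hconst := constant_of_has_deriv_right_zero
    (fun t ht => (hderiv t ht).continuousAt.continuousWithinAt)
    (fun t ht => (hderiv t (Ico_subset_Icc_self ht)).hasDerivWithinAt) z hx.2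
  have hb : m (y, 0) = 0 := min_eq_right (by linarith [hbottom y hx.1])
  have hm00 : m (y, z) = 0 := by simpa [hb] using hconst
  have := min_eq_right_iff.1 hm00
  linarith
end
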